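/- For every integer n ≥ 3, in the set S_n(132,312): f_{123}(S_n(132,312)) = f_{321}(S_n(132,312)) = binom(n,3)·2^{n−3}, and f_{213}(S_n(132,312)) = f_{231}(S_n(132,312)) = binom(n,3)·2^{n−3}. -/

import Mathlib

open Finset

/-- Number of occurrences of the length-3 pattern `q` (given by its sequence of values)
in the permutation `σ` of `Fin n`: triples of indices `ι 0 < ι 1 < ι 2` whose values under
`σ` are in the same relative order as the values of `q`. -/
def occ (n : ℕ) (q : Fin 3 → ℕ) (σ : Equiv.Perm (Fin n)) : ℕ :=
  (Finset.univ.filter fun ι : Fin 3 → Fin n =>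
    (∀ j l : Fin 3, j < l → ι j < ι l) ∧
    (∀ j l : Fin 3, q j < q l ↔ σ (ι j) < σ (ι l))).card

/-- The set `S_n(R)` of permutations of `{1,…,n}` avoiding every pattern in `R`. -/
def avoiders (n : ℕ) (R : List (Fin 3 → ℕ)) : Finset (Equiv.Perm (Fin n)) :=
  Finset.univ.filter fun σ => ∀ q ∈ R, occ n q σ = 0

/-- `f_q(S_n(R))`: the total number of occurrences of the pattern `q` among
all permutations in `S_n(R)`. -/
def fCnt (n : ℕ) (q : Fin 3 → ℕ) (R : List (Fin 3 → ℕ)) : ℕ :=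
  ∑ σ ∈ avoiders n R, occ n q σ

def p123 : Fin 3 → ℕ := ![1, 2, 3]
def p132 : Fin 3 → ℕ := ![1, 3, 2]
def p213 : Fin 3 → ℕ := ![2, 1, 3]
def p231 : Fin 3 → ℕ := ![2, 3, 1]
def p312 : Fin 3 → ℕ := ![3, 1, 2]
def p321 : Fin 3 → ℕ := ![3, 2, 1]

/-- Words over `Bool` with some letters prescribed: each free letter contributes a factor `2`. -/
lemma card_words_with_prescribed_letters {α : Type*} [Fintype α] [DecidableEq α]
    (t : Finset α) (f : α → Bool) :
    (univ.filter fun b : α → Bool => ∀ a ∈ t, b a = f a).card =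
      2 ^ (Fintype.card α - t.card) := by
  have h : (univ.filter fun b : α → Bool => ∀ a ∈ t, b a = f a) =
      Fintype.piFinset fun a => if a ∈ t then {f a} else univ := by
    ext b
    simp only [mem_filter, mem_univ, true_and, Fintype.mem_piFinset]
    refine forall_congr' fun a => ?_
    by_cases ha : a ∈ t <;> simp [ha]
  rw [h, Fintype.card_piFinset]
  have h2 : ∀ a, (if a ∈ t then ({f a} : Finset Bool) else univ).card =
      if a ∈ t then 1 else 2 := by
    intro a
    split_ifs <;> simp
  simp only [h2]
  rw [prod_ite, prod_const_one, one_mul, prod_const, filter_notMem_eq_sdiff, card_univ_sdiff]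

lemma card_filter_lt_of_lt_fin (n k : ℕ) :
    (univ.filter fun ι : Fin k → Fin n => ∀ j l, j < l → ι j < ι l).card = n.choose k := by
  rw [← Fintype.card_subtype]
  let e : {ι : Fin k → Fin n // ∀ j l, j < l → ι j < ι l} ≃ (Fin k ↪o Fin n) :=
    { toFun := fun ι => OrderEmbedding.ofStrictMono ι.1 fun j l h => ι.2 j l h
      invFun := fun g => ⟨g, fun _ _ h => g.strictMono h⟩
      left_inv := fun _ => rfl
      right_inv := fun _ => rfl }
  rw [← Nat.card_eq_fintype_card, Nat.card_congr e,
    Nat.card_congr Set.powersetCard.ofFinEmbEquiv, Set.powersetCard.card, Nat.card_fin]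

lemma Equiv.Perm.eq_of_lt_iff_lt {α : Type*} [LinearOrder α] [WellFoundedLT α]
    {σ τ : Equiv.Perm α} (h : ∀ i j, i < j → (σ i < σ j ↔ τ i < τ j)) : σ = τ := by
  have h' : ∀ i j, σ i < σ j → τ i < τ j := by
    intro i j hij
    rcases lt_trichotomy i j with hlt | rfl | hlt
    · exact (h i j hlt).1 hij
    · exact absurd hij (lt_irrefl _)
    · have h1 : ¬ τ j < τ i := fun h2 => lt_asymm hij ((h j i hlt).2 h2)
      exact lt_of_le_of_ne (not_lt.1 h1) fun h2 => hlt.ne' (τ.injective h2)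
  have hm : StrictMono (τ * σ⁻¹) := fun a b hab => h' _ _ (by simpa using hab)
  have hid : (⇑(τ * σ⁻¹) : α → α) = id :=
    (StrictMono.range_inj hm strictMono_id).1 (by
      rw [(Equiv.surjective (τ * σ⁻¹)).range_eq, Set.range_id])
  ext1 i
  simpa using (congrFun hid (σ i)).symm

/-- The value at position `i` of the permutation in which the entry at position `i` is larger
than all earlier entries if `b i` holds, and smaller than all of them otherwise. -/
def wordRank {n : ℕ} (b : Fin n → Bool) (i : Fin n) : ℕ :=
  (if b i then (i : ℕ) else 0) + (univ.filter fun j => i < j ∧ b j = false).card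

lemma wordRank_lt_of_up {n : ℕ} {b : Fin n → Bool} {i k : Fin n} (hik : i < k)
    (hk : b k = true) : wordRank b i < wordRank b k := by
  have hsub : (univ.filter fun j => i < j ∧ b j = false) ⊆
      Ioo i k ∪ (univ.filter fun j => k < j ∧ b j = false) := by
    intro j
    simp only [mem_filter, mem_univ, true_and, mem_union, mem_Ioo]
    rintro ⟨h1, h2⟩
    rcases lt_trichotomy j k with h | rfl | h
    · exact Or.inl ⟨h1, h⟩
    · simp [hk] at h2
    · exact Or.inr ⟨h, h2⟩
  have hcard := (card_le_card hsub).trans (card_union_le _ _)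
  rw [Fin.card_Ioo] at hcard
  have hik' : (i : ℕ) < k := hik
  have hi : (if b i then (i : ℕ) else 0) ≤ i := by split_ifs <;> omega
  simp only [wordRank, hk, if_true] at *
  omega

lemma wordRank_lt_of_down {n : ℕ} {b : Fin n → Bool} {i k : Fin n} (hik : i < k)
    (hk : b k = false) : wordRank b k < wordRank b i := by
  have hss : (univ.filter fun j => k < j ∧ b j = false) ⊂
      (univ.filter fun j => i < j ∧ b j = false) := by
    rw [ssubset_iff_of_subset]
    · exact ⟨k, by simp [hik, hk], by simp⟩
    · intro j
      simp only [mem_filter, mem_univ, true_and]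
      exact fun h => ⟨hik.trans h.1, h.2⟩
  have := card_lt_card hss
  simp only [wordRank, hk, Bool.false_eq_true, if_false]
  omega

lemma wordRank_lt {n : ℕ} (b : Fin n → Bool) (i : Fin n) : wordRank b i < n := by
  have hsub : (univ.filter fun j => i < j ∧ b j = false) ⊆ Ioi i := by
    intro j
    simp only [mem_filter, mem_univ, true_and, mem_Ioi]
    exact fun h => h.1
  have h := card_le_card hsub
  rw [Fin.card_Ioi] at h
  have hi : (if b i then (i : ℕ) else 0) ≤ i := by split_ifs <;> omega
  have := i.2
  unfold wordRank
  omega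

lemma wordRank_injective {n : ℕ} (b : Fin n → Bool) : Function.Injective (wordRank b) := by
  have key : ∀ i k, i < k → wordRank b i ≠ wordRank b k := by
    intro i k hik
    cases hk : b k
    · exact (wordRank_lt_of_down hik hk).ne'
    · exact (wordRank_lt_of_up hik hk).ne
  intro i k h
  by_contra hne
  rcases lt_or_gt_of_ne hne with h' | h'
  · exact key _ _ h' h
  · exact key _ _ h' h.symm

/-- The permutation whose entry at position `i` is larger than all earlier entries if `b i`
holds, and smaller than all of them otherwise. -/
noncomputable def wordPerm {n : ℕ} (b : Fin n → Bool) : Equiv.Perm (Fin n) :=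
  Equiv.ofBijective (fun i => (⟨wordRank b i, wordRank_lt b i⟩ : Fin n))
    (Finite.injective_iff_bijective.1 fun _ _ h => wordRank_injective b (Fin.mk.inj h))

lemma wordPerm_lt_iff {n : ℕ} {b : Fin n → Bool} {i k : Fin n} (hik : i < k) :
    wordPerm b i < wordPerm b k ↔ b k = true := by
  have h : wordPerm b i < wordPerm b k ↔ wordRank b i < wordRank b k := Iff.rfl
  rw [h]
  cases hk : b k
  · simpa using (wordRank_lt_of_down hik hk).le
  · simpa using wordRank_lt_of_up hik hk

lemma mem_avoiders_iff {n : ℕ} {σ : Equiv.Perm (Fin n)} :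
    σ ∈ avoiders n [p132, p312] ↔
      ∀ i j k, i < j → j < k → (σ i < σ k ↔ σ j < σ k) := by
  simp only [avoiders, occ, mem_filter, mem_univ, true_and, List.mem_cons, List.not_mem_nil,
    or_false, forall_eq_or_imp, forall_eq, card_eq_zero, filter_eq_empty_iff, forall_const]
  constructor
  · rintro ⟨h1, h2⟩ i j k hij hjk
    have h1' := @h1 ![i, j, k]
    have h2' := @h2 ![i, j, k]
    have n1 : σ i ≠ σ j := fun h => hij.ne (σ.injective h)
    have n2 : σ j ≠ σ k := fun h => hjk.ne (σ.injective h)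
    have n3 : σ i ≠ σ k := fun h => (hij.trans hjk).ne (σ.injective h)
    simp [Fin.forall_fin_succ, p132, p312, hij, hjk, hij.trans hjk] at h1' h2'
    grind
  · intro h
    constructor <;>
    · intro ι ⟨hι, hq⟩
      have := h (ι 0) (ι 1) (ι 2) (hι 0 1 (by decide)) (hι 1 2 (by decide))
      rw [← hq, ← hq] at this
      simp [p132, p312] at this

lemma avoiders_eq_image_wordPerm {n : ℕ} [NeZero n] :
    avoiders n [p132, p312] =
      (univ.filter fun b : Fin n → Bool => b 0 = true).image wordPerm := by
  ext σ
  simp only [mem_avoiders_iff, mem_image, mem_filter, mem_univ, true_and]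
  constructor
  · intro h
    refine ⟨fun k => decide (k = 0 ∨ σ 0 < σ k), by simp, ?_⟩
    refine Equiv.Perm.eq_of_lt_iff_lt fun i k hik => ?_
    have hk : k ≠ 0 := ((Fin.zero_le i).trans_lt hik).ne'
    rw [wordPerm_lt_iff hik]
    simp only [hk, false_or, decide_eq_true_eq]
    rcases eq_or_ne i 0 with rfl | hi
    · rfl
    · exact h 0 i k (Fin.pos_iff_ne_zero.2 hi) hik
  · rintro ⟨b, -, rfl⟩ i j k hij hjk
    rw [wordPerm_lt_iff (hij.trans hjk), wordPerm_lt_iff hjk]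

lemma wordPerm_injOn {n : ℕ} [NeZero n] :
    Set.InjOn wordPerm {b : Fin n → Bool | b 0 = true} := by
  intro b hb c hc h
  funext k
  rcases eq_or_ne k 0 with rfl | hk
  · exact hb.trans hc.symm
  · have hk' := Fin.pos_iff_ne_zero.2 hk
    rw [Bool.eq_iff_iff, ← wordPerm_lt_iff hk', ← wordPerm_lt_iff hk', h]

/-- A pattern whose third entry is the largest or the smallest, as recorded by `y`, occurs in
`wordPerm b` exactly at the triples where `b` takes the prescribed values. -/
lemma pattern_wordPerm_iff {n : ℕ} {b : Fin n → Bool} {q : Fin 3 → ℕ} {x y : Bool}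
    (h01 : if x then q 0 < q 1 else q 1 < q 0)
    (h02 : if y then q 0 < q 2 else q 2 < q 0)
    (h12 : if y then q 1 < q 2 else q 2 < q 1)
    {ι : Fin 3 → Fin n} (hι : ∀ j l, j < l → ι j < ι l) :
    (∀ j l, q j < q l ↔ wordPerm b (ι j) < wordPerm b (ι l)) ↔
      b (ι 1) = x ∧ b (ι 2) = y := by
  have l01 := hι 0 1 (by decide)
  have l02 := hι 0 2 (by decide)
  have l12 := hι 1 2 (by decide)
  have w01 := wordPerm_lt_iff (b := b) l01
  have w02 := wordPerm_lt_iff (b := b) l02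
  have w12 := wordPerm_lt_iff (b := b) l12
  have n01 := (wordPerm b).injective.ne l01.ne
  have n02 := (wordPerm b).injective.ne l02.ne
  have n12 := (wordPerm b).injective.ne l12.ne
  simp only [Fin.forall_fin_succ, Fin.forall_fin_zero, Fin.succ_zero_eq_one, Fin.isValue,
    Fin.succ_one_eq_two, lt_irrefl]
  cases x <;> cases y <;> simp at h01 h02 h12 <;> grind

lemma card_words_pattern {n : ℕ} [NeZero n] (x y : Bool) {ι : Fin 3 → Fin n}
    (hι : ∀ j l, j < l → ι j < ι l) :
    (univ.filter fun b : Fin n → Bool => b 0 = true ∧ b (ι 1) = x ∧ b (ι 2) = y).card =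
      2 ^ (n - 3) := by
  have h1 : ι 1 ≠ 0 := ((Fin.zero_le _).trans_lt (hι 0 1 (by decide))).ne'
  have h2 : ι 2 ≠ 0 := ((Fin.zero_le _).trans_lt (hι 0 2 (by decide))).ne'
  have h12 : ι 2 ≠ ι 1 := (hι 1 2 (by decide)).ne'
  have h := card_words_with_prescribed_letters ({0, ι 1, ι 2} : Finset (Fin n))
    fun i => if i = 0 then true else if i = ι 1 then x else y
  rw [card_eq_three.2 ⟨0, ι 1, ι 2, h1.symm, h2.symm, h12.symm, rfl⟩, Fintype.card_fin] at h
  simpa [h1, h2, h12] using h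

lemma fCnt_avoiders_eq {n : ℕ} [NeZero n] {q : Fin 3 → ℕ} (x y : Bool)
    (h01 : if x then q 0 < q 1 else q 1 < q 0)
    (h02 : if y then q 0 < q 2 else q 2 < q 0)
    (h12 : if y then q 1 < q 2 else q 2 < q 1) :
    fCnt n q [p132, p312] = n.choose 3 * 2 ^ (n - 3) := by
  unfold fCnt
  rw [avoiders_eq_image_wordPerm, sum_image (by simpa using wordPerm_injOn)]
  have hocc : ∀ b : Fin n → Bool, occ n q (wordPerm b) =
      ∑ ι ∈ univ.filter (fun ι : Fin 3 → Fin n => ∀ j l, j < l → ι j < ι l),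
        if b (ι 1) = x ∧ b (ι 2) = y then 1 else 0 := by
    intro b
    rw [occ, ← filter_filter, card_filter]
    refine sum_congr rfl fun ι hι => if_congr ?_ rfl rfl
    exact pattern_wordPerm_iff h01 h02 h12 (mem_filter.1 hι).2
  simp only [hocc]
  rw [sum_comm, ← card_filter_lt_of_lt_fin, card_eq_sum_ones, sum_mul]
  refine sum_congr rfl fun ι hι => ?_
  rw [← card_filter, filter_filter, one_mul]
  exact card_words_pattern x y (mem_filter.1 hι).2


/-- Theorem `td1`: in `S_n(132,312)` for `n ≥ 3`,
`f_{123} = f_{321} = C(n,3)·2^{n−3}` and `f_{213} = f_{231} = C(n,3)·2^{n−3}`. -/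
theorem stmt_8 (n : ℕ) (hn : 3 ≤ n) :
    (fCnt n p123 [p132, p312] = n.choose 3 * 2 ^ (n - 3) ∧
     fCnt n p321 [p132, p312] = n.choose 3 * 2 ^ (n - 3)) ∧
    (fCnt n p213 [p132, p312] = n.choose 3 * 2 ^ (n - 3) ∧
     fCnt n p231 [p132, p312] = n.choose 3 * 2 ^ (n - 3)) := by
  have : NeZero n := ⟨by omega⟩
  refine ⟨⟨fCnt_avoiders_eq true true ?_ ?_ ?_, fCnt_avoiders_eq false false ?_ ?_ ?_⟩,
    fCnt_avoiders_eq false true ?_ ?_ ?_, fCnt_avoiders_eq true false ?_ ?_ ?_⟩ <;> decide
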